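/- Only finitely many bivariate power series occur as bigraded Hilbert series of quotients S/I where I ⊂ S = k[x₀,x₁,y₀,y₁] is generated by r bihomogeneous forms of prescribed bidegrees (d₁,e₁),…,(d_r,e_r). -/

import Mathlib

open MvPolynomial

/-- The bigrading on `S = k[x₀,x₁,y₀,y₁]`: `deg x₀ = deg x₁ = (1,0)`,
`deg y₀ = deg y₁ = (0,1)`. -/
noncomputable def bidegWt : Fin 4 → ℕ × ℕ := ![(1,0), (1,0), (0,1), (0,1)]

/-- The bigraded Hilbert function of `S/I`. -/
noncomputable def hilb (k : Type*) [Field k] (I : Ideal (MvPolynomial (Fin 4) k))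
    (p : ℕ × ℕ) : ℕ :=
  Module.finrank k
    ((weightedHomogeneousSubmodule k bidegWt p).map (Ideal.Quotient.mkₐ k I).toLinearMap)

/-- The exponents of the leading monomials of the nonzero elements of an ideal. -/
def leadingExponents {σ R : Type*} [CommRing R] (m : MonomialOrder σ)
    (I : Ideal (MvPolynomial σ R)) : Set (σ →₀ ℕ) :=
  {d | ∃ g ∈ I, g ≠ 0 ∧ m.degree g = d}

theorem degree_map_of_leadingCoeff_ne_zero {σ R K : Type*} [CommRing R] [CommRing K] (m : MonomialOrder σ)
    (φ : R →+* K) {g : MvPolynomial σ R} (hg : φ (m.leadingCoeff g) ≠ 0) :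
    map φ g ≠ 0 ∧ m.degree (map φ g) = m.degree g := by
  have hc : (map φ g).coeff (m.degree g) ≠ 0 := by rwa [coeff_map]
  refine ⟨fun h => hc (by simp [h]), m.toSyn.injective (le_antisymm ?_ ?_)⟩
  · exact m.degree_le_iff.mpr fun c hc => m.le_degree (support_map_subset φ g hc)
  · exact m.le_degree (mem_support_iff.mpr hc)

theorem exists_finite_forall_exists_le {α : Type*} [PartialOrder α] [WellQuasiOrderedLE α]
    (s : Set α) : ∃ t ⊆ s, t.Finite ∧ ∀ a ∈ s, ∃ b ∈ t, b ≤ a := by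
  refine ⟨{x | Minimal (· ∈ s) x}, fun x hx => hx.prop,
    WellQuasiOrderedLE.finite_of_isAntichain (setOfPred_minimal_antichain _), fun a ha => ?_⟩
  obtain ⟨b, hba, hb⟩ := exists_minimal_le_of_wellFoundedLT (· ∈ s) a ha
  exact ⟨b, hb, hba⟩

/-- Over a domain, the leading monomials of an ideal are unchanged by specialization outside a
proper hypersurface. -/
theorem exists_leadingExponents_map_eq {σ R K : Type*} [Finite σ] [CommRing R] [IsDomain R]
    [Field K] (m : MonomialOrder σ) (I : Ideal (MvPolynomial σ R)) :
    ∃ f : R, f ≠ 0 ∧ ∀ φ : R →+* K, Function.Surjective φ → φ f ≠ 0 →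
      leadingExponents m (I.map (map φ)) = leadingExponents m I := by
  obtain ⟨t, htL, htfin, ht⟩ := exists_finite_forall_exists_le (leadingExponents m I)
  have htL' : ∀ d ∈ t, ∃ g ∈ I, g ≠ 0 ∧ m.degree g = d := htL
  choose! G hGI hG0 hGd using htL'
  refine ⟨∏ d ∈ htfin.toFinset, m.leadingCoeff (G d),
    Finset.prod_ne_zero_iff.mpr fun d hd => ?_, fun φ hφ hf => ?_⟩
  · exact m.leadingCoeff_ne_zero_iff.mpr (hG0 d (by simpa using hd))
  have hlc : ∀ d ∈ t, φ (m.leadingCoeff (G d)) ≠ 0 := fun d hd => by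
    rw [map_prod] at hf
    exact Finset.prod_ne_zero_iff.mp hf d (by simpa using hd)
  apply Set.Subset.antisymm
  · have key : ∀ s : m.syn, ∀ g ∈ I, m.toSyn (m.degree g) = s → map φ g ≠ 0 →
        m.degree (map φ g) ∈ leadingExponents m I := by
      intro s
      induction s using WellFoundedLT.induction with
      | ind s ih =>
        intro g hg hs hne
        have hg0 : g ≠ 0 := by rintro rfl; simp at hne
        by_cases hc : φ (m.leadingCoeff g) = 0
        · obtain ⟨d, hd, hdg⟩ := ht (m.degree g) ⟨g, hg, hg0, rfl⟩
          have hmap : map φ (m.sPolynomial g (G d)) = C (φ (m.leadingCoeff (G d))) * map φ g := by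
            simp [MonomialOrder.sPolynomial, hGd d hd, tsub_eq_zero_of_le hdg, map_monomial, hc]
          have hC : (C (φ (m.leadingCoeff (G d))) : MvPolynomial σ K) ≠ 0 :=
            (map_ne_zero_iff _ (C_injective σ K)).mpr (hlc d hd)
          have hdeg : m.degree (map φ (m.sPolynomial g (G d))) = m.degree (map φ g) := by
            rw [hmap, m.degree_mul hC hne, m.degree_C, zero_add]
          have hne' : map φ (m.sPolynomial g (G d)) ≠ 0 := hmap ▸ mul_ne_zero hC hne
          rw [← hdeg]
          refine ih _ ?_ _ (I.sub_mem (I.mul_mem_left _ hg) (I.mul_mem_left _ (hGI d hd))) rfl hne'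
          have := m.degree_sPolynomial_lt_sup_degree (f := g) (g := G d)
            (fun h => hne' (by simp [h]))
          rwa [hGd d hd, sup_eq_left.mpr hdg, hs] at this
        · exact ⟨g, hg, hg0, (degree_map_of_leadingCoeff_ne_zero m φ hc).2.symm⟩
    rintro _ ⟨h, hh, h0, rfl⟩
    obtain ⟨g, hg, rfl⟩ := (Ideal.mem_map_iff_of_surjective _ (map_surjective φ hφ)).mp hh
    exact key _ g hg rfl h0
  · intro a ha
    obtain ⟨d, hd, hda⟩ := ht a ha
    obtain ⟨h0, hdeg⟩ := degree_map_of_leadingCoeff_ne_zero m φ (hlc d hd)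
    have h1 : (monomial (a - d) (1 : K)) ≠ 0 := by simp
    refine ⟨monomial (a - d) 1 * map φ (G d),
      Ideal.mul_mem_left _ _ (Ideal.mem_map_of_mem _ (hGI d hd)), mul_ne_zero h1 h0, ?_⟩
    classical
    rw [m.degree_mul h1 h0, hdeg, hGd d hd, m.degree_monomial, if_neg one_ne_zero,
      tsub_add_cancel_of_le hda]

theorem weightedHomogeneousComponent_mem_span {σ ι M R : Type*} [CommRing R] [AddCommMonoid M]
    [DecidableEq M] {w : σ → M} {F : ι → MvPolynomial σ R} {n : ι → M}
    (hF : ∀ i, IsWeightedHomogeneous w (F i) (n i)) {g : MvPolynomial σ R}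
    (hg : g ∈ Ideal.span (Set.range F)) (p : M) :
    weightedHomogeneousComponent w p g ∈ Ideal.span (Set.range F) := by
  let := weightedGradedAlgebra R w
  refine weightedHomogeneousComponent_mem_of_mem R w
    (Ideal.homogeneous_span (weightedHomogeneousSubmodule R w) _ ?_) hg p
  rintro _ ⟨i, rfl⟩
  exact ⟨n i, hF i⟩

/-- Macaulay's theorem: the monomials outside the initial ideal count the Hilbert function. -/
theorem hilb_eq_card {k : Type*} [Field k] (m : MonomialOrder (Fin 4))
    {I : Ideal (MvPolynomial (Fin 4) k)}
    (hI : ∀ g ∈ I, ∀ p, weightedHomogeneousComponent bidegWt p g ∈ I) (p : ℕ × ℕ) :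
    hilb k I p = Nat.card {a // Finsupp.weight bidegWt a = p ∧ a ∉ leadingExponents m I} := by
  classical
  set T := {a // Finsupp.weight bidegWt a = p ∧ a ∉ leadingExponents m I}
  set v : T → MvPolynomial (Fin 4) k ⧸ I := fun a => Ideal.Quotient.mkₐ k I (monomial a.1 1)
  have hli : LinearIndependent k v := by
    rw [linearIndependent_iff]
    intro l hl
    by_contra hne
    set g : MvPolynomial (Fin 4) k := l.sum fun a c => monomial a.1 c with hg
    have hcoeff : ∀ a : T, g.coeff a.1 = l a := by
      intro a
      simp only [hg, Finsupp.sum, coeff_sum, coeff_monomial, Subtype.val_inj]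
      rw [Finset.sum_ite_eq' l.support a l]
      simp +contextual
    have hg0 : g ≠ 0 := by
      intro h
      exact hne (Finsupp.ext fun a => by rw [← hcoeff, h]; simp)
    have hgI : g ∈ I := by
      rw [← Ideal.Quotient.eq_zero_iff_mem, ← Ideal.Quotient.mkₐ_eq_mk k, hg, ← hl,
        Finsupp.linearCombination_apply, Finsupp.sum, Finsupp.sum, map_sum]
      refine Finset.sum_congr rfl fun a _ => ?_
      rw [← map_smul, smul_monomial, smul_eq_mul, mul_one]
    have hsupp : ∃ a : T, a.1 = m.degree g := by
      by_contra! h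
      refine m.coeff_degree_ne_zero_iff.mpr hg0 ?_
      simp only [hg, Finsupp.sum, coeff_sum, coeff_monomial]
      exact Finset.sum_eq_zero fun a _ => if_neg (h a)
    obtain ⟨a, ha⟩ := hsupp
    exact a.2.2 ⟨g, hgI, hg0, ha.symm⟩
  have hspan : (weightedHomogeneousSubmodule k bidegWt p).map
      (Ideal.Quotient.mkₐ k I).toLinearMap = Submodule.span k (Set.range v) := by
    apply le_antisymm
    · have hmon : ∀ s : m.syn, ∀ a, m.toSyn a = s → Finsupp.weight bidegWt a = p →
          Ideal.Quotient.mkₐ k I (monomial a 1) ∈ Submodule.span k (Set.range v) := by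
        intro s
        induction s using WellFoundedLT.induction with
        | ind s ih =>
          intro a has hap
          by_cases ha : a ∈ leadingExponents m I
          · obtain ⟨g, hgI, hg0, rfl⟩ := ha
            set h := weightedHomogeneousComponent bidegWt p g with hh
            have hc : m.leadingCoeff g ≠ 0 := m.leadingCoeff_ne_zero_iff.mpr hg0
            have hcoeff : ∀ b, h.coeff b = if Finsupp.weight bidegWt b = p then g.coeff b else 0 :=
              coeff_weightedHomogeneousComponent p g
            have hzero : Ideal.Quotient.mkₐ k I h = 0 :=
              Ideal.Quotient.eq_zero_iff_mem.mpr (hI g hgI p)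
            have hdeg : m.degree g ∈ h.support := by
              rw [mem_support_iff, hcoeff, if_pos hap]; exact hc
            rw [h.as_sum, map_sum, ← Finset.add_sum_erase _ _ hdeg, hcoeff, if_pos hap] at hzero
            have hsmul : ∀ b c, Ideal.Quotient.mkₐ k I (monomial b c) =
                c • Ideal.Quotient.mkₐ k I (monomial b 1) := fun b c => by
              rw [← map_smul, smul_monomial, smul_eq_mul, mul_one]
            rw [hsmul] at hzero
            rw [← Submodule.smul_mem_iff _ hc]
            refine (eq_neg_of_add_eq_zero_left hzero).symm ▸
              Submodule.neg_mem _ (Submodule.sum_mem _ fun b hb => ?_)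
            rw [hsmul]
            have hb' := Finset.mem_erase.mp hb
            have hbc := mem_support_iff.mp hb'.2
            rw [hcoeff] at hbc
            obtain ⟨hbp, hbg⟩ := ite_ne_right_iff.mp hbc
            refine Submodule.smul_mem _ _ (ih _ ?_ b rfl hbp)
            rw [← has]
            exact lt_of_le_of_ne (m.le_degree (mem_support_iff.mpr hbg))
              (m.toSyn.injective.ne hb'.1)
          · exact Submodule.subset_span ⟨⟨a, hap, ha⟩, rfl⟩
      rintro _ ⟨g, hg, rfl⟩
      rw [g.as_sum, map_sum]
      refine Submodule.sum_mem _ fun a ha => ?_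
      rw [← mul_one (g.coeff a), ← smul_eq_mul, ← smul_monomial, map_smul]
      exact Submodule.smul_mem _ _ (hmon _ a rfl (hg (mem_support_iff.mp ha)))
    · rw [Submodule.span_le]
      rintro _ ⟨a, rfl⟩
      exact ⟨_, isWeightedHomogeneous_monomial _ _ _ a.2.1, rfl⟩
  rw [hilb, hspan]
  exact Module.finrank_eq_nat_card_basis (Module.Basis.span hli)

/-- In a family of ideals over a Noetherian parameter ring, the specializations at rational points
have finitely many sets of leading monomials. -/
theorem finite_leadingExponents_map {σ k A : Type*} [Finite σ] [Field k] [CommRing A] [Algebra k A]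
    [IsNoetherianRing A] (m : MonomialOrder σ) (I : Ideal (MvPolynomial σ A)) :
    (Set.range fun φ : A →ₐ[k] k => leadingExponents m (I.map (map (φ : A →+* k)))).Finite := by
  suffices H : ∀ J : Ideal A, ((fun φ : A →ₐ[k] k => leadingExponents m
      (I.map (map (φ : A →+* k)))) '' {φ | J ≤ RingHom.ker φ}).Finite by
    refine (H ⊥).subset ?_
    rintro _ ⟨φ, rfl⟩
    exact ⟨φ, bot_le (a := RingHom.ker φ), rfl⟩
  intro J
  induction J using WellFoundedGT.induction with
  | ind J ih =>
    have hsup : ∀ (φ : A →ₐ[k] k), J ≤ RingHom.ker φ → ∀ a, φ a = 0 →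
        J ⊔ Ideal.span {a} ≤ RingHom.ker φ := fun φ hφ a ha =>
      sup_le hφ ((Ideal.span_singleton_le_iff_mem _).mpr ha)
    by_cases hJ : J.IsPrime
    · obtain ⟨f, hf0, hf⟩ := exists_leadingExponents_map_eq (K := k) m
        (I.map (map (Ideal.Quotient.mk J)))
      obtain ⟨f, rfl⟩ := Ideal.Quotient.mk_surjective f
      rw [Ne, Ideal.Quotient.eq_zero_iff_mem] at hf0
      have hlt : J < J ⊔ Ideal.span {f} := by simpa using hf0
      refine ((ih _ hlt).union (Set.finite_singleton
        (leadingExponents m (I.map (map (Ideal.Quotient.mk J)))))).subset ?_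
      rintro _ ⟨φ, hφ, rfl⟩
      by_cases hφf : φ f = 0
      · exact Or.inl ⟨φ, hsup φ hφ f hφf, rfl⟩
      · right
        set ψ : A ⧸ J →+* k := Ideal.Quotient.lift J (φ : A →+* k) fun a ha => hφ ha
        have hψ : ψ.comp (Ideal.Quotient.mk J) = (φ : A →+* k) := RingHom.ext fun a => rfl
        have hsurj : Function.Surjective ψ := fun c =>
          ⟨Ideal.Quotient.mk J (algebraMap k A c), φ.commutes c⟩
        have := hf ψ hsurj hφf
        rw [Ideal.map_map] at this
        have hcomp : (map ψ).comp (map (σ := σ) (Ideal.Quotient.mk J)) = map (φ : A →+* k) := by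
          refine RingHom.ext fun g => ?_
          rw [RingHom.comp_apply, map_map, hψ]
        rwa [hcomp] at this
    · rw [Ideal.isPrime_iff] at hJ
      by_cases htop : J = ⊤
      · convert Set.finite_empty
        rw [Set.image_eq_empty, Set.eq_empty_iff_forall_notMem]
        intro φ hφ
        exact RingHom.ker_ne_top φ (top_le_iff.mp (htop ▸ hφ))
      · push Not at hJ
        obtain ⟨a, b, hab, ha, hb⟩ := hJ htop
        have hlta : J < J ⊔ Ideal.span {a} := by simpa using ha
        have hltb : J < J ⊔ Ideal.span {b} := by simpa using hb
        refine ((ih _ hlta).union (ih _ hltb)).subset ?_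
        rintro _ ⟨φ, hφ, rfl⟩
        have h : φ a * φ b = 0 := by rw [← map_mul]; exact hφ hab
        rcases mul_eq_zero.mp h with h | h
        · exact Or.inl ⟨φ, hsup φ hφ a h, rfl⟩
        · exact Or.inr ⟨φ, hsup φ hφ b h, rfl⟩

theorem degree_eq_weight_bidegWt (a : Fin 4 →₀ ℕ) :
    a.degree = (Finsupp.weight bidegWt a).1 + (Finsupp.weight bidegWt a).2 := by
  simp [Finsupp.weight_apply, Finsupp.degree_eq_sum, Finsupp.sum_fintype, Fin.sum_univ_four,
    bidegWt, add_assoc]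

theorem finite_setOf_weight_bidegWt_eq (p : ℕ × ℕ) :
    {a : Fin 4 →₀ ℕ | Finsupp.weight bidegWt a = p}.Finite := by
  refine (Finsupp.finite_of_degree_le (p.1 + p.2)).subset ?_
  rintro a rfl
  exact (degree_eq_weight_bidegWt a).le

/-- Only finitely many bivariate series occur as bigraded Hilbert series of
quotients `S/I` where `I` is generated by `r` bihomogeneous forms of prescribed
bidegrees `(d₁,e₁),…,(d_r,e_r)`. -/
theorem finite_hilbert_series (k : Type*) [Field k] [Infinite k]
    (r : ℕ) (d e : Fin r → ℕ) :
    Set.Finite { h : ℕ × ℕ → ℕ |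
      ∃ F : Fin r → MvPolynomial (Fin 4) k,
        (∀ i, IsWeightedHomogeneous bidegWt (F i) (d i, e i)) ∧
        h = hilb k (Ideal.span (Set.range F)) } := by
  classical
  set T : Fin r → Finset (Fin 4 →₀ ℕ) := fun i =>
    (finite_setOf_weight_bidegWt_eq (d i, e i)).toFinset with hT
  set m : MonomialOrder (Fin 4) := MonomialOrder.lex
  set U : Fin r → MvPolynomial (Fin 4) (MvPolynomial (Σ i, T i) k) := fun i =>
    ∑ a : T i, monomial a.1 (X ⟨i, a⟩) with hU
  refine ((finite_leadingExponents_map (k := k) m (Ideal.span (Set.range U))).image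
    fun L p => Nat.card {a // Finsupp.weight bidegWt a = p ∧ a ∉ L}).subset ?_
  rintro _ ⟨F, hF, rfl⟩
  set φ : MvPolynomial (Σ i, T i) k →ₐ[k] k := aeval fun x => (F x.1).coeff x.2.1 with hφ
  refine ⟨_, ⟨φ, rfl⟩, ?_⟩
  have hUF : ∀ i, map (φ : MvPolynomial (Σ i, T i) k →+* k) (U i) = F i := by
    intro i
    have hsub : (F i).support ⊆ T i := fun a ha => by
      simpa [hT] using hF i (mem_support_iff.mp ha)
    have hmap : map (φ : MvPolynomial (Σ i, T i) k →+* k) (U i) =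
        ∑ a : T i, monomial a.1 ((F i).coeff a.1) := by
      simp [hU, hφ, map_monomial]
    rw [hmap, Finset.sum_coe_sort (T i) fun a => monomial a ((F i).coeff a)]
    conv_rhs => rw [(F i).as_sum]
    refine (Finset.sum_subset hsub fun a _ ha => ?_).symm
    rw [notMem_support_iff.mp ha, monomial_zero]
  have hspan : (Ideal.span (Set.range U)).map (map (φ : MvPolynomial (Σ i, T i) k →+* k)) =
      Ideal.span (Set.range F) := by
    rw [Ideal.map_span, ← Set.range_comp]
    exact congrArg (fun G => Ideal.span (Set.range G)) (funext hUF)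
  funext p
  simp only [hspan]
  exact (hilb_eq_card m (fun g hg p => weightedHomogeneousComponent_mem_span hF hg p) p).symm
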